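/- Let L be a finite distributive lattice and let f, g be join-endomorphisms of L. Let h be the greatest join-endomorphism of L that lies pointwise below both f and g. Then for every join-irreducible element a of L, h(a) = f(a) ⊓ g(a). -/

import Mathlib

/-- A (bottom-preserving) join-endomorphism of a lattice with bottom. -/
def IsJoinEndo {L : Type*} [Lattice L] [OrderBot L] (f : L → L) : Prop :=
  f ⊥ = ⊥ ∧ ∀ a b : L, f (a ⊔ b) = f a ⊔ f b

theorem IsJoinEndo.monotone {L : Type*} [Lattice L] [OrderBot L] {f : L → L}
    (hf : IsJoinEndo f) : Monotone f := fun a b hab => by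
  rw [← sup_eq_right.mpr hab, hf.2]
  exact le_sup_left

open Classical in
/-- The step function at a join-prime element is a join-endomorphism. -/
theorem SupPrime.isJoinEndo_ite {L : Type*} [Lattice L] [OrderBot L] {a : L}
    (ha : SupPrime a) (c : L) : IsJoinEndo fun x => if a ≤ x then c else ⊥ := by
  refine ⟨if_neg fun h => ha.ne_bot (le_bot_iff.mp h), fun x y => ?_⟩
  by_cases hx : a ≤ x <;> by_cases hy : a ≤ y <;> simp [ha.le_sup, hx, hy]

theorem stmt_2 {L : Type*} [DistribLattice L] [OrderBot L] [Fintype L]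
    (f g h : L → L) (hf : IsJoinEndo f) (hg : IsJoinEndo g) (hh : IsJoinEndo h)
    (hhf : ∀ a, h a ≤ f a) (hhg : ∀ a, h a ≤ g a)
    (hmax : ∀ k : L → L, IsJoinEndo k → (∀ a, k a ≤ f a) → (∀ a, k a ≤ g a) →
      ∀ a, k a ≤ h a) :
    ∀ a : L, SupIrred a → h a = f a ⊓ g a := by
  intro a ha
  refine le_antisymm (le_inf (hhf a) (hhg a)) ?_
  have hstep := hmax _ (ha.supPrime.isJoinEndo_ite (f a ⊓ g a))
    (fun x => ?_) (fun x => ?_) a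
  · simpa using hstep
  · by_cases hx : a ≤ x
    · simpa [hx] using inf_le_left.trans (hf.monotone hx)
    · simp [hx]
  · by_cases hx : a ≤ x
    · simpa [hx] using inf_le_right.trans (hg.monotone hx)
    · simp [hx]
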